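/- There is no pair (X₀, A₀), where X₀ is a compact metrizable topological space and A₀ is an analytic subset of X₀^ℕ (with the product topology), such that for every Polish space X and every analytic subset A of X^ℕ exactly one of the following holds: (a) there is a Borel map c : X → ℕ such that for every sequence (x_i)_{i∈ℕ} ∈ A the values c(x_i) are not all equal; (b) there is a continuous map u : X₀ → X such that for every sequence (x_i)_{i∈ℕ} ∈ A₀, the sequence (u(x_i))_{i∈ℕ} belongs to A. -/

import Mathlib

open Set

/-- The sequences in Baire space that are unbounded in some coordinate. -/
def unboundedSequences : Set (ℕ → ℕ → ℕ) :=
  {x | ∃ n, ∀ m, ∃ i, m ≤ x i n}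

theorem measurableSet_unboundedSequences : MeasurableSet unboundedSequences := by
  simp only [unboundedSequences, ofPred_exists, ofPred_forall]
  refine .iUnion fun n => .iInter fun m => .iUnion fun i => ?_
  exact measurableSet_le measurable_const
    ((measurable_pi_apply n).comp (measurable_pi_apply i))

/-- Every countable coloring of Baire space is constant on some sequence that is unbounded in
some coordinate. -/
theorem exists_mem_unboundedSequences_forall_eq (c : (ℕ → ℕ) → ℕ) :
    ∃ x ∈ unboundedSequences, ∀ i j, c (x i) = c (x j) := by
  by_contra! h
  have bounded : ∀ n, ∃ m, ∀ y, c y = n → y n < m := by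
    intro n
    by_contra! hn
    choose x hx hle using hn
    obtain ⟨i, j, hij⟩ := h x ⟨n, fun m => ⟨m, hle m⟩⟩
    exact hij ((hx i).trans (hx j).symm)
  choose b hb using bounded
  exact lt_irrefl _ (hb (c b) b rfl)

/-- A sequence in the image of a compact space is bounded in every coordinate. -/
theorem comp_notMem_unboundedSequences {Y : Type*} [TopologicalSpace Y] [CompactSpace Y]
    {u : Y → ℕ → ℕ} (hu : Continuous u) (x : ℕ → Y) :
    (fun i => u (x i)) ∉ unboundedSequences := by
  rintro ⟨n, hn⟩
  obtain ⟨b, hb⟩ := (isCompact_range ((continuous_apply n).comp hu)).bddAbove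
  obtain ⟨i, hi⟩ := hn (b + 1)
  have : u (x i) n ≤ b := hb ⟨x i, rfl⟩
  exact absurd (hi.trans this) (Nat.not_succ_le_self b)

theorem stmt5 :
    ¬ ∃ (X₀ : Type) (t₀ : TopologicalSpace X₀) (A₀ : Set (ℕ → X₀)),
      @CompactSpace X₀ t₀ ∧ @TopologicalSpace.MetrizableSpace X₀ t₀ ∧
      @MeasureTheory.AnalyticSet (ℕ → X₀)
        (@Pi.topologicalSpace ℕ (fun _ => X₀) (fun _ => t₀)) A₀ ∧
      ∀ (X : Type) (tX : TopologicalSpace X), @PolishSpace X tX →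
        ∀ A : Set (ℕ → X),
          @MeasureTheory.AnalyticSet (ℕ → X)
            (@Pi.topologicalSpace ℕ (fun _ => X) (fun _ => tX)) A →
          Xor'
            (∃ c : X → ℕ, @Measurable X ℕ (@borel X tX) ⊤ c ∧
              ∀ x ∈ A, ¬ ∀ i j, c (x i) = c (x j))
            (∃ u : X₀ → X, @Continuous X₀ X t₀ tX u ∧
              ∀ x ∈ A₀, (fun i => u (x i)) ∈ A) := by
  rintro ⟨X₀, t₀, A₀, hcompact, -, -, h⟩
  have hne : A₀.Nonempty := by
    rw [nonempty_iff_ne_empty]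
    rintro rfl
    rcases h Unit inferInstance inferInstance ∅ MeasureTheory.analyticSet_empty with
      ⟨-, hb⟩ | ⟨-, ha⟩
    · exact hb ⟨fun _ => (), continuous_const, by simp⟩
    · exact ha ⟨fun _ => 0, @measurable_const _ _ ⊤ (borel Unit) 0, by simp⟩
  rcases h (ℕ → ℕ) inferInstance inferInstance unboundedSequences
    measurableSet_unboundedSequences.analyticSet with ⟨⟨c, -, hc⟩, -⟩ | ⟨⟨u, hu, hA⟩, -⟩
  · obtain ⟨x, hx, hconst⟩ := exists_mem_unboundedSequences_forall_eq c
    exact hc x hx hconst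
  · obtain ⟨x, hx⟩ := hne
    exact comp_notMem_unboundedSequences hu x (hA x hx)
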